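/- arXiv:2410.02008 — 2 statements merged into one kernel-verified Lean document; each statement's English description precedes it below -/
import Mathlib

section
/- Let ℓ be a prime number and let A_1, …, A_r be pairwise commuting matrices in GL_n(ℤ_ℓ) satisfying A_i ≡ I (mod ℓ²) for all i, where ℤ_ℓ denotes the ring of ℓ-adic integers. Then for each i the matrix logarithm log A_i := Σ_{k ≥ 1} (−1)^{k+1} (A_i − I)^k / k converges in the n × n matrices over ℚ_ℓ, and for any nonnegative integers a_1, …, a_r one has ∏_{i=1}^r A_i^{a_i} = I if and only if Σ_{i=1}^r a_i · log A_i = 0. -/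
open scoped BigOperators

open Filter Topology

/-! ### The sup norm on square matrices over an ultrametric ring -/

/-- Over an ultrametric normed ring the entrywise supremum norm on square matrices is
submultiplicative. -/
@[reducible]
noncomputable def Matrix.supNormedRing {n K : Type*} [Fintype n] [DecidableEq n] [NormedRing K]
    [IsUltrametricDist K] : NormedRing (Matrix n n K) where
  __ := Matrix.normedAddCommGroup
  __ := Matrix.instRing
  norm_mul_le A B := by
    let _ : NormedAddCommGroup (Matrix n n K) := Matrix.normedAddCommGroup
    change ‖A * B‖ ≤ ‖A‖ * ‖B‖
    have hnonneg : 0 ≤ ‖A‖ * ‖B‖ := by positivity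
    refine (Matrix.norm_le_iff hnonneg).2 fun i j => ?_
    rw [Matrix.mul_apply]
    refine IsUltrametricDist.norm_sum_le_of_forall_le_of_nonneg hnonneg fun k _ => ?_
    exact (norm_mul_le _ _).trans (mul_le_mul A.norm_entry_le_entrywise_sup_norm
      B.norm_entry_le_entrywise_sup_norm (norm_nonneg _) (norm_nonneg _))

/-! ### The `p`-adic logarithm in an ultrametric Banach algebra -/

section PadicLog

variable {p : ℕ} [Fact p.Prime]

theorem Padic.norm_inv_natCast_le (k : ℕ) : ‖(k : ℚ_[p])⁻¹‖ ≤ k := by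
  rcases eq_or_ne k 0 with rfl | hk
  · simp
  have hk' : (k : ℚ_[p]) ≠ 0 := by exact_mod_cast hk
  rw [norm_inv, Padic.norm_eq_zpow_neg_valuation hk', Padic.valuation_natCast, zpow_neg, inv_inv,
    zpow_natCast]
  exact_mod_cast Nat.le_of_dvd (Nat.pos_of_ne_zero hk) pow_padicValNat_dvd

theorem Padic.tendsto_prime_pow_atTop : Tendsto (fun m : ℕ => (p : ℚ_[p]) ^ m) atTop (𝓝 0) :=
  tendsto_pow_atTop_nhds_zero_of_norm_lt_one Padic.norm_p_lt_one

theorem Padic.tendsto_choose_prime_pow_sub_one (k : ℕ) :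
    Tendsto (fun m : ℕ => ((p ^ m - 1).choose k : ℚ_[p])) atTop (𝓝 ((-1) ^ k)) := by
  induction k with
  | zero => simp
  | succ k ih =>
    have hrec : ∀ m : ℕ, ((p ^ m - 1).choose (k + 1) : ℚ_[p]) =
        (p : ℚ_[p]) ^ m * (p ^ m - 1).choose k / (k + 1) - (p ^ m - 1).choose k := by
      intro m
      obtain ⟨N, hN⟩ : ∃ N, p ^ m = N + 1 :=
        Nat.exists_eq_add_one.2 (pow_pos (Fact.out : p.Prime).pos m)
      have hmul := congrArg (Nat.cast (R := ℚ_[p])) (Nat.add_one_mul_choose_eq N k)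
      have hN' : (p : ℚ_[p]) ^ m = N + 1 := by exact_mod_cast congrArg (Nat.cast (R := ℚ_[p])) hN
      rw [Nat.choose_succ_succ] at hmul
      push_cast at hmul
      have hk : (k + 1 : ℚ_[p]) ≠ 0 := by exact_mod_cast k.succ_ne_zero
      rw [hN, hN', Nat.add_sub_cancel, hmul]
      field_simp
      ring
    simp_rw [hrec]
    convert ((Padic.tendsto_prime_pow_atTop.mul ih).div_const ((k : ℚ_[p]) + 1)).sub ih using 2
    ring

variable {R : Type*} [NormedRing R] [NormedAlgebra ℚ_[p] R]

variable (p) in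
/-- `L` is the limit of the difference quotients `(A ^ p ^ m - 1) / p ^ m`, i.e. the derivative
at `0` of the `p`-adic one-parameter group generated by `A`. -/
def HasPadicLog (A L : R) : Prop :=
  Tendsto (fun m : ℕ => ((p : ℚ_[p]) ^ m)⁻¹ • (A ^ p ^ m - 1)) atTop (𝓝 L)

namespace HasPadicLog

theorem unique {A L M : R} (hL : HasPadicLog p A L) (hM : HasPadicLog p A M) : L = M :=
  tendsto_nhds_unique hL hM

variable (p R) in
theorem one : HasPadicLog p (1 : R) 0 := by
  simp [HasPadicLog]

theorem tendsto_pow {A L : R} (h : HasPadicLog p A L) :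
    Tendsto (fun m : ℕ => A ^ p ^ m) atTop (𝓝 1) := by
  have hlim := ((Padic.tendsto_prime_pow_atTop (p := p)).smul h).add_const 1
  rw [zero_smul, zero_add] at hlim
  refine hlim.congr fun m => ?_
  have hp : (p : ℚ_[p]) ^ m ≠ 0 := pow_ne_zero _ (by exact_mod_cast (Fact.out : p.Prime).ne_zero)
  rw [smul_inv_smul₀ hp, sub_add_cancel]

theorem mul {A B L M : R} (hAB : Commute A B) (hA : HasPadicLog p A L) (hB : HasPadicLog p B M) :
    HasPadicLog p (A * B) (L + M) := by
  have hlim := (Tendsto.mul hA hB.tendsto_pow).add hB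
  rw [mul_one] at hlim
  refine hlim.congr fun m => ?_
  rw [hAB.mul_pow, smul_mul_assoc, ← smul_add, sub_mul, one_mul, sub_add_sub_cancel]

theorem pow {A L : R} (h : HasPadicLog p A L) (a : ℕ) :
    HasPadicLog p (A ^ a) ((a : ℚ_[p]) • L) := by
  induction a with
  | zero => simpa using one p R
  | succ a ih =>
    rw [pow_succ, Nat.cast_succ, add_smul, one_smul]
    exact ih.mul ((Commute.refl A).pow_left a) h

theorem list_prod_ofFn {r : ℕ} {A L : Fin r → R} (hcomm : ∀ i j, Commute (A i) (A j))
    (h : ∀ i, HasPadicLog p (A i) (L i)) :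
    HasPadicLog p (List.ofFn A).prod (∑ i, L i) := by
  induction r with
  | zero => simpa using one p R
  | succ r ih =>
    rw [List.ofFn_succ, List.prod_cons, Fin.sum_univ_succ]
    refine (h 0).mul ?_ (ih (fun i j => hcomm _ _) fun i => h _)
    refine Commute.list_prod_right _ _ fun x hx => ?_
    obtain ⟨i, rfl⟩ := (List.mem_ofFn' _ _).1 hx
    exact hcomm _ _

end HasPadicLog

theorem norm_padicLog_term_le {X : R} (hX : ‖X‖ ≤ 1 / 4) {c : ℚ_[p]} (hc : ‖c‖ ≤ 1) (k : ℕ) :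
    ‖(c / (k + 1 : ℕ)) • X ^ (k + 1)‖ ≤ ‖X‖ * ((k + 1 : ℕ) * (1 / 4) ^ k) := by
  have hcoeff : ‖c / (k + 1 : ℕ)‖ ≤ (k + 1 : ℕ) := by
    rw [div_eq_mul_inv, norm_mul]
    exact (mul_le_of_le_one_left (norm_nonneg _) hc).trans (Padic.norm_inv_natCast_le _)
  calc ‖(c / (k + 1 : ℕ)) • X ^ (k + 1)‖
      ≤ ‖c / (k + 1 : ℕ)‖ * ‖X ^ (k + 1)‖ := norm_smul_le _ _
    _ ≤ (k + 1 : ℕ) * (‖X‖ ^ k * ‖X‖) := by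
        rw [← pow_succ]
        gcongr
        exact norm_pow_le' X k.succ_pos
    _ ≤ (k + 1 : ℕ) * ((1 / 4) ^ k * ‖X‖) := by gcongr
    _ = ‖X‖ * ((k + 1 : ℕ) * (1 / 4) ^ k) := by ring

theorem summable_succ_mul_one_quarter_pow :
    Summable fun k : ℕ => ((k + 1 : ℕ) : ℝ) * (1 / 4) ^ k := by
  have hr : ‖(1 / 4 : ℝ)‖ < 1 := by norm_num
  refine ((summable_pow_mul_geometric_of_norm_lt_one 1 hr).add
    (summable_geometric_of_norm_lt_one hr)).congr fun k => ?_
  push_cast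
  ring

theorem succ_mul_one_quarter_pow_le (k : ℕ) :
    ((k + 1 + 1 : ℕ) : ℝ) * (1 / 4) ^ (k + 1) ≤ 1 / 2 := by
  induction k with
  | zero => norm_num
  | succ k ih =>
    have hpos : (0 : ℝ) < (1 / 4) ^ k := by positivity
    push_cast [pow_succ] at ih ⊢
    nlinarith [mul_nonneg hpos.le (Nat.cast_nonneg (α := ℝ) k)]

theorem inv_smul_pow_prime_pow_sub_one (A : R) (m : ℕ) :
    ((p : ℚ_[p]) ^ m)⁻¹ • (A ^ p ^ m - 1) =
      ∑' k : ℕ, (((p ^ m - 1).choose k : ℚ_[p]) / (k + 1 : ℕ)) • (A - 1) ^ (k + 1) := by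
  obtain ⟨N, hN⟩ : ∃ N, p ^ m = N + 1 :=
    Nat.exists_eq_add_one.2 (pow_pos (Fact.out : p.Prime).pos m)
  have hN' : (p : ℚ_[p]) ^ m = (N + 1 : ℕ) := by exact_mod_cast congrArg (Nat.cast (R := ℚ_[p])) hN
  rw [tsum_eq_sum (s := Finset.range (N + 1)), hN', hN]
  · have hexp : A ^ (N + 1) - 1 =
        ∑ k ∈ Finset.range (N + 1), ((N + 1).choose (k + 1) : ℚ_[p]) • (A - 1) ^ (k + 1) := by
      conv_lhs => rw [← sub_add_cancel A 1, (Commute.one_right (A - 1)).add_pow]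
      rw [Finset.sum_range_succ']
      simp [Nat.cast_smul_eq_nsmul, nsmul_eq_mul, (Nat.cast_commute _ _).eq]
    rw [hexp, Finset.smul_sum]
    refine Finset.sum_congr rfl fun k _ => ?_
    rw [smul_smul, Nat.add_sub_cancel]
    congr 1
    have hmul := congrArg (Nat.cast (R := ℚ_[p])) (Nat.add_one_mul_choose_eq N k)
    have hk : ((k + 1 : ℕ) : ℚ_[p]) ≠ 0 := by exact_mod_cast k.succ_ne_zero
    have hn : ((N + 1 : ℕ) : ℚ_[p]) ≠ 0 := by exact_mod_cast N.succ_ne_zero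
    rw [Nat.cast_mul, Nat.cast_mul] at hmul
    field_simp
    linear_combination -hmul
  · intro k hk
    rw [Nat.choose_eq_zero_of_lt (by rw [Finset.mem_range] at hk; omega)]
    simp

variable [CompleteSpace R]

variable (p) in
theorem summable_padicLog {A : R} (hA : ‖A - 1‖ ≤ 1 / 4) :
    Summable fun k : ℕ => ((-1 : ℚ_[p]) ^ (k + 1 + 1) / (k + 1 : ℕ)) • (A - 1) ^ (k + 1) :=
  .of_norm_bounded (summable_succ_mul_one_quarter_pow.mul_left ‖A - 1‖) fun k =>
    norm_padicLog_term_le hA (by simp) k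

variable (p) in
theorem hasPadicLog_tsum {A : R} (hA : ‖A - 1‖ ≤ 1 / 4) :
    HasPadicLog p A
      (∑' k : ℕ, ((-1 : ℚ_[p]) ^ (k + 1 + 1) / (k + 1 : ℕ)) • (A - 1) ^ (k + 1)) := by
  unfold HasPadicLog
  simp_rw [inv_smul_pow_prime_pow_sub_one]
  refine tendsto_tsum_of_dominated_convergence
    (summable_succ_mul_one_quarter_pow.mul_left ‖A - 1‖) (fun k => ?_)
    (.of_forall fun m k => norm_padicLog_term_le hA ?_ k)
  · rw [pow_succ (-1 : ℚ_[p]) (k + 1), pow_succ (-1 : ℚ_[p]) k, mul_assoc, neg_one_mul, neg_neg,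
      mul_one]
    exact ((Padic.tendsto_choose_prime_pow_sub_one k).div_const _).smul_const _
  · exact_mod_cast Padic.norm_int_le_one ((p ^ m - 1).choose k : ℤ)

variable [IsUltrametricDist R]

theorem HasPadicLog.eq_zero_iff {A L : R} (hA : ‖A - 1‖ ≤ 1 / 4) (h : HasPadicLog p A L) :
    L = 0 ↔ A = 1 := by
  constructor
  · rintro rfl
    have hsum := (summable_padicLog p hA).hasSum.tendsto_sum_nat
    rw [(hasPadicLog_tsum p hA).unique h] at hsum
    have hlim := ((tendsto_add_atTop_iff_nat 1).2 hsum).sub_const (A - 1)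
    have hle : ‖(0 : R) - (A - 1)‖ ≤ ‖A - 1‖ * (1 / 2) := by
      refine le_of_tendsto hlim.norm (.of_forall fun N => ?_)
      rw [Finset.sum_range_succ']
      simp only [zero_add, Nat.cast_one, pow_one, div_one, one_add_one_eq_two, even_two,
        Even.neg_pow, one_pow, one_smul, add_sub_cancel_right]
      refine IsUltrametricDist.norm_sum_le_of_forall_le_of_nonneg (by positivity) fun k _ => ?_
      exact (norm_padicLog_term_le hA (by simp) (k + 1)).trans
        (mul_le_mul_of_nonneg_left (succ_mul_one_quarter_pow_le k) (norm_nonneg _))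
    rw [zero_sub, norm_neg] at hle
    exact sub_eq_zero.1 (norm_le_zero_iff.1 (by linarith))
  · rintro rfl
    exact h.unique (one p R)

end PadicLog

/-- The elements of an ultrametric normed ring at distance at most `1 / 4` from `1`. -/
def quarterBallSubmonoid (R : Type*) [NormedRing R] [IsUltrametricDist R] : Submonoid R where
  carrier := {A | ‖A - 1‖ ≤ 1 / 4}
  one_mem' := by simp
  mul_mem' {A B} hA hB := by
    simp only [Set.mem_ofPred_eq] at hA hB ⊢
    rw [show A * B - 1 = (A - 1) * (B - 1) + ((A - 1) + (B - 1)) by noncomm_ring]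
    refine (IsUltrametricDist.norm_add_le_max _ _).trans (max_le ?_ ?_)
    · refine (norm_mul_le _ _).trans ?_
      nlinarith [norm_nonneg (A - 1), norm_nonneg (B - 1)]
    · exact (IsUltrametricDist.norm_add_le_max _ _).trans (max_le hA hB)

/-- Let `ℓ` be a prime and let `A 1, …, A r` be pairwise commuting
matrices in `GL_n(ℤ_ℓ)` with `A i ≡ I (mod ℓ²)`.  Then for each `i` the matrix logarithm
`log A i = Σ_{k ≥ 1} (-1)^{k+1} (A i - I)^k / k` converges in the `n × n` matrices over
`ℚ_ℓ` (to some matrix `L i`), and for all nonnegative integers `a 1, …, a r` one has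
`∏ i, (A i)^(a i) = I` if and only if `Σ i, (a i) • L i = 0`. -/
theorem matrix_log_detects_trivial_products
    (ℓ : ℕ) [Fact ℓ.Prime] (n r : ℕ)
    (A : Fin r → GL (Fin n) ℤ_[ℓ])
    (hcomm : ∀ i j : Fin r, Commute (A i) (A j))
    (hcong : ∀ i : Fin r, ∀ k l : Fin n,
      ((ℓ : ℤ_[ℓ]) ^ 2) ∣ (((A i : Matrix (Fin n) (Fin n) ℤ_[ℓ]) - 1) k l)) :
    ∃ L : Fin r → Matrix (Fin n) (Fin n) ℚ_[ℓ],
      (∀ i : Fin r,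
        Filter.Tendsto
          (fun N : ℕ => ∑ k ∈ Finset.range N,
            ((-1 : ℚ_[ℓ]) ^ (k + 1 + 1) / (k + 1 : ℕ)) •
              ((A i : Matrix (Fin n) (Fin n) ℤ_[ℓ]).map ((↑) : ℤ_[ℓ] → ℚ_[ℓ]) - 1) ^ (k + 1))
          Filter.atTop (nhds (L i))) ∧
      ∀ a : Fin r → ℕ,
        (List.ofFn fun i : Fin r => A i ^ a i).prod = 1 ↔ (∑ i : Fin r, (a i : ℚ_[ℓ]) • L i) = 0 := by
  let _ : NormedRing (Matrix (Fin n) (Fin n) ℚ_[ℓ]) := Matrix.supNormedRing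
  let _ : NormedAlgebra ℚ_[ℓ] (Matrix (Fin n) (Fin n) ℚ_[ℓ]) :=
    { Matrix.instAlgebra with norm_smul_le := Matrix.normedSpace.norm_smul_le }
  have : IsUltrametricDist (Matrix (Fin n) (Fin n) ℚ_[ℓ]) :=
    inferInstanceAs (IsUltrametricDist (Fin n → Fin n → ℚ_[ℓ]))
  have : @CompleteSpace (Matrix (Fin n) (Fin n) ℚ_[ℓ]) PseudoMetricSpace.toUniformSpace :=
    inferInstanceAs (CompleteSpace (Fin n → Fin n → ℚ_[ℓ]))
  let φ : GL (Fin n) ℤ_[ℓ] →* Matrix (Fin n) (Fin n) ℚ_[ℓ] :=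
    (RingHom.mapMatrix (m := Fin n) (PadicInt.Coe.ringHom (p := ℓ))).toMonoidHom.comp
      (Units.coeHom _)
  have hφ : Function.Injective φ := fun A B h =>
    Units.ext (Matrix.map_injective Subtype.val_injective h)
  have hsmall : ∀ i, φ (A i) ∈ quarterBallSubmonoid (Matrix (Fin n) (Fin n) ℚ_[ℓ]) := by
    intro i
    refine (Matrix.norm_le_iff (by norm_num)).2 fun k l => ?_
    have hentry : (φ (A i) - 1) k l =
        (((A i : Matrix (Fin n) (Fin n) ℤ_[ℓ]) - 1) k l : ℤ_[ℓ]) := by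
      have hone : ((1 : Matrix (Fin n) (Fin n) ℤ_[ℓ]) k l : ℚ_[ℓ]) =
          (1 : Matrix (Fin n) (Fin n) ℚ_[ℓ]) k l := by
        simp only [Matrix.one_apply]; split_ifs <;> simp
      rw [Matrix.sub_apply, Matrix.sub_apply, PadicInt.coe_sub, hone]
      rfl
    obtain ⟨c, hc⟩ := hcong i k l
    have htwo : (2 : ℝ) ≤ ℓ := by exact_mod_cast (Fact.out : ℓ.Prime).two_le
    have hinv : (ℓ : ℝ)⁻¹ ≤ 1 / 2 := by
      rw [one_div]
      exact inv_anti₀ two_pos htwo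
    have hinv₀ : (0 : ℝ) ≤ (ℓ : ℝ)⁻¹ := by positivity
    rw [hentry, hc, ← PadicInt.norm_def, norm_mul, norm_pow, PadicInt.norm_p]
    calc (ℓ : ℝ)⁻¹ ^ 2 * ‖c‖ ≤ (1 / 2) ^ 2 * 1 := by
          gcongr
          exact c.norm_le_one
      _ = 1 / 4 := by norm_num
  refine ⟨fun i => ∑' k : ℕ,
    ((-1 : ℚ_[ℓ]) ^ (k + 1 + 1) / (k + 1 : ℕ)) • (φ (A i) - 1) ^ (k + 1),
    fun i => (summable_padicLog ℓ (hsmall i)).hasSum.tendsto_sum_nat, fun a => ?_⟩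
  have hlog := HasPadicLog.list_prod_ofFn (p := ℓ)
    (fun i j => (((hcomm i j).map φ).pow_pow (a i) (a j)))
    fun i => (hasPadicLog_tsum ℓ (hsmall i)).pow (a i)
  have hmem : (List.ofFn fun i => φ (A i) ^ a i).prod ∈
      quarterBallSubmonoid (Matrix (Fin n) (Fin n) ℚ_[ℓ]) := by
    refine Submonoid.list_prod_mem _ fun x hx => ?_
    obtain ⟨i, rfl⟩ := (List.mem_ofFn' _ _).1 hx
    exact pow_mem (hsmall i) _
  refine Iff.trans ?_ (hlog.eq_zero_iff hmem).symm
  rw [← map_eq_one_iff φ hφ, map_list_prod, List.map_ofFn]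
  simp only [Function.comp_def, map_pow]
end

section
/- Let ℓ be a prime number and n a positive integer. The kernel of the reduction homomorphism GL_n(ℤ_ℓ) → GL_n(ℤ/ℓ²ℤ) is a torsion-free group: if A ∈ GL_n(ℤ_ℓ) satisfies A ≡ I (mod ℓ²) and A^m = I for some positive integer m, then A = I. -/
/-- The binomial expansion of `(1 + x) ^ m` to second order, in a possibly noncommutative ring. -/
theorem exists_one_add_pow_eq_add_sq_mul {R : Type*} [Ring R] (x : R) (m : ℕ) :
    ∃ q : R, (1 + x) ^ m = 1 + m * x + x ^ 2 * q := by
  induction m with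
  | zero => exact ⟨0, by simp⟩
  | succ m ih =>
    obtain ⟨q, hq⟩ := ih
    refine ⟨m + q * (1 + x), ?_⟩
    rw [pow_succ, hq]
    have hc : x ^ 2 * (m : R) = m * x ^ 2 := ((Nat.cast_commute m (x ^ 2)).eq).symm
    rw [mul_add (x ^ 2), hc]
    push_cast
    noncomm_ring

theorem PadicInt.prime_natCast_dvd {ℓ : ℕ} [Fact ℓ.Prime] {p : ℕ} (hp : p.Prime) :
    (p : ℤ_[ℓ]) ∣ ℓ := by
  obtain rfl | h := eq_or_ne p ℓ
  · exact dvd_rfl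
  · refine IsUnit.dvd (PadicInt.isUnit_iff.2 ?_)
    rw [PadicInt.norm_natCast_eq_one_iff]
    exact (Nat.coprime_primes Fact.out hp).2 h.symm

theorem PadicInt.eq_zero_of_forall_pow_dvd {ℓ : ℕ} [Fact ℓ.Prime] {x : ℤ_[ℓ]}
    (h : ∀ k : ℕ, (ℓ : ℤ_[ℓ]) ^ (k + 2) ∣ x) : x = 0 := by
  by_contra hx
  obtain ⟨k, hk⟩ := FiniteMultiplicity.of_prime_left PadicInt.prime_p hx
  exact hk ((pow_dvd_pow _ (by omega)).trans (h k))

/-- If `1 + X` has prime order and `X` is divisible by `ℓ ^ (k + 2)`, then `X` is divisible by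
one more power of `ℓ`. -/
theorem Matrix.exists_eq_pow_succ_smul_of_one_add_pow_eq_one {ι : Type*} [Fintype ι]
    [DecidableEq ι] {ℓ : ℕ} [Fact ℓ.Prime] {p : ℕ} (hp : p.Prime) {X : Matrix ι ι ℤ_[ℓ]}
    (hX : (1 + X) ^ p = 1) {k : ℕ} (hk : ∃ B, X = (ℓ : ℤ_[ℓ]) ^ (k + 2) • B) :
    ∃ B, X = (ℓ : ℤ_[ℓ]) ^ (k + 3) • B := by
  obtain ⟨B, hB⟩ := hk
  obtain ⟨Q, hQ⟩ := exists_one_add_pow_eq_add_sq_mul X p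
  obtain ⟨c, hc⟩ := PadicInt.prime_natCast_dvd (ℓ := ℓ) hp
  have hpX : (p : ℤ_[ℓ]) • X = -(X ^ 2 * Q) := by
    rw [hX, add_assoc, left_eq_add] at hQ
    rw [Nat.cast_smul_eq_nsmul, nsmul_eq_mul]
    exact eq_neg_of_add_eq_zero_left hQ
  have hℓ : (ℓ : ℤ_[ℓ]) ≠ 0 := PadicInt.prime_p.ne_zero
  refine ⟨((ℓ : ℤ_[ℓ]) ^ k * c) • -(B ^ 2 * Q), smul_right_injective _ hℓ ?_⟩
  calc (ℓ : ℤ_[ℓ]) • X = c • ((p : ℤ_[ℓ]) • X) := by rw [smul_smul, mul_comm c, ← hc]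
    _ = c • -(((ℓ : ℤ_[ℓ]) ^ (k + 2) • B) ^ 2 * Q) := by rw [hpX, ← hB]
    _ = _ := by
      simp only [smul_pow, smul_mul_assoc, smul_neg, smul_smul]
      congr 2
      ring

theorem Matrix.eq_zero_of_one_add_prime_pow_eq_one {ι : Type*} [Fintype ι] [DecidableEq ι]
    {ℓ : ℕ} [Fact ℓ.Prime] {p : ℕ} (hp : p.Prime) {X : Matrix ι ι ℤ_[ℓ]}
    (hX : (1 + X) ^ p = 1) (h : ∃ B, X = (ℓ : ℤ_[ℓ]) ^ 2 • B) : X = 0 := by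
  have hall : ∀ k : ℕ, ∃ B, X = (ℓ : ℤ_[ℓ]) ^ (k + 2) • B := by
    intro k
    induction k with
    | zero => exact h
    | succ k ih => exact Matrix.exists_eq_pow_succ_smul_of_one_add_pow_eq_one hp hX ih
  ext i j
  refine PadicInt.eq_zero_of_forall_pow_dvd fun k => ?_
  obtain ⟨B, hB⟩ := hall k
  exact ⟨B i j, by simpa using congrFun (congrFun hB i) j⟩

theorem Matrix.eq_zero_of_one_add_pow_eq_one {ι : Type*} [Fintype ι] [DecidableEq ι]
    {ℓ : ℕ} [Fact ℓ.Prime] {m : ℕ} (hm : m ≠ 0) {X : Matrix ι ι ℤ_[ℓ]}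
    (hX : (1 + X) ^ m = 1) (h : ∃ B, X = (ℓ : ℤ_[ℓ]) ^ 2 • B) : X = 0 := by
  induction m using induction_on_primes generalizing X with
  | zero => exact absurd rfl hm
  | one => simpa using hX
  | prime_mul p m hp ih =>
    obtain ⟨B, hB⟩ := h
    obtain ⟨Q, hQ⟩ := exists_one_add_pow_eq_add_sq_mul X p
    have hY : (1 + X) ^ p = 1 + (p * X + X ^ 2 * Q) := by rw [hQ, add_assoc]
    have hY0 : p * X + X ^ 2 * Q = 0 := by
      refine ih (right_ne_zero_of_mul hm) (by rw [← hY, ← pow_mul, hX]) ⟨p * B + B * (X * Q), ?_⟩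
      rw [pow_two X, mul_assoc, smul_add, ← mul_smul_comm, ← smul_mul_assoc, ← hB]
    exact Matrix.eq_zero_of_one_add_prime_pow_eq_one hp (by rw [hY, hY0, add_zero]) ⟨B, hB⟩

/-- Let `ℓ` be a prime and `n` a positive integer.  The kernel of the
reduction homomorphism `GL_n(ℤ_ℓ) → GL_n(ℤ/ℓ²ℤ)` is torsion free: if `A ∈ GL_n(ℤ_ℓ)`
satisfies `A ≡ I (mod ℓ²)` (entrywise) and `A ^ m = I` for some positive integer `m`,
then `A = I`. -/
theorem kernel_of_reduction_mod_sq_torsion_free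
    (ℓ : ℕ) [Fact ℓ.Prime] (n : ℕ) (hn : 0 < n)
    (A : GL (Fin n) ℤ_[ℓ])
    (hA : ∀ i j : Fin n,
      ((ℓ : ℤ_[ℓ]) ^ 2) ∣ (((A : Matrix (Fin n) (Fin n) ℤ_[ℓ]) - 1) i j))
    (m : ℕ) (hm : 0 < m) (hAm : A ^ m = 1) :
    A = 1 := by
  choose B hB using hA
  have hX : (A : Matrix (Fin n) (Fin n) ℤ_[ℓ]) - 1 = 0 := by
    refine Matrix.eq_zero_of_one_add_pow_eq_one hm.ne' ?_ ⟨Matrix.of B, ?_⟩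
    · rw [add_sub_cancel, ← Units.val_pow_eq_pow_val, hAm, Units.val_one]
    · ext i j
      simpa using hB i j
  exact Units.ext (sub_eq_zero.1 hX)
end
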